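/- Let n and N be positive integers and let A_1, …, A_N be real numbers satisfying −(n+1) ≤ A_j ≤ n(n+1) for all j. Then the linear operator on ℝ[x] given by the composition (∏_{k=0}^{n−1} (δ − k(k+1)·I)) ∘ (∏_{j=1}^{N} (δ − A_j·I)), where I is the identity operator, maps every hyperbolic polynomial to a hyperbolic polynomial. -/

import Mathlib

open Polynomial Finset

/-- A real polynomial is hyperbolic if it is zero or all of its complex roots are real. -/
def Hyperbolic (p : Polynomial ℝ) : Prop :=
  p = 0 ∨ ∀ z : ℂ, Polynomial.aeval z p = 0 → z.im = 0

/-- The Legendre differential operator `δ[q] = (x²−1)q″ + 2xq′` as a linear endomorphism. -/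
noncomputable def legendreDelta : Module.End ℝ (Polynomial ℝ) :=
  (LinearMap.mulLeft ℝ ((X : Polynomial ℝ) ^ 2 - 1)).comp
      (Polynomial.derivative.comp Polynomial.derivative) +
    (LinearMap.mulLeft ℝ (2 * X : Polynomial ℝ)).comp Polynomial.derivative

theorem aux_prod {ι : Type*} [DecidableEq ι] (s : Finset ι) (r : ι → ℂ) (z : ℂ) (h : ∀ i ∈ s, z - r i ≠ 0) :
    (∏ i ∈ s, (X - C (r i))).eval z ≠ 0 ∧
    (derivative (∏ i ∈ s, (X - C (r i)))).eval z
      = (∏ i ∈ s, (X - C (r i))).eval z * ∑ i ∈ s, (z - r i)⁻¹ ∧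
    (derivative (derivative (∏ i ∈ s, (X - C (r i))))).eval z
      = (∏ i ∈ s, (X - C (r i))).eval z *
        ((∑ i ∈ s, (z - r i)⁻¹) ^ 2 - ∑ i ∈ s, ((z - r i)⁻¹) ^ 2) := by
  induction s using Finset.induction_on with
  | empty => simp
  | insert a s ha ih =>
    obtain ⟨h0, h1, h2⟩ := ih (fun i hi => h i (Finset.mem_insert_of_mem hi))
    have hz := h a (Finset.mem_insert_self _ _)
    rw [Finset.prod_insert ha, Finset.sum_insert ha, Finset.sum_insert ha]
    simp only [derivative_mul, derivative_sub, derivative_X, derivative_C, derivative_add,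
      eval_mul, eval_add, eval_sub, eval_X, eval_C, sub_zero, one_mul]
    rw [h1, h2]
    refine ⟨mul_ne_zero hz h0, ?_, ?_⟩
    · field_simp
    · field_simp
      ring

theorem aux_repr (g : ℝ[X]) (hg : Hyperbolic g) (hg0 : g ≠ 0) (z : ℂ) (hz : 0 < z.im) :
    ∃ w : Fin g.natDegree → ℂ, (∀ i, (w i).im < 0) ∧ aeval z g ≠ 0 ∧
      aeval z (derivative g) = aeval z g * ∑ i, w i ∧
      aeval z (derivative (derivative g)) = aeval z g * ((∑ i, w i) ^ 2 - ∑ i, (w i) ^ 2) := by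
  have hr : ∀ z : ℂ, aeval z g = 0 → z.im = 0 := by
    rcases hg with h | h
    · exact absurd h hg0
    · exact h
  set G : ℂ[X] := g.map (algebraMap ℝ ℂ) with hG
  have hG0 : G ≠ 0 := (Polynomial.map_ne_zero_iff (algebraMap ℝ ℂ).injective).2 hg0
  have hsp : G.Splits := IsAlgClosed.splits G
  have hcard : G.roots.toList.length = g.natDegree := by
    rw [Multiset.length_toList, ← hsp.natDegree_eq_card_roots, hG, natDegree_map]
  obtain ⟨r, hrl⟩ : ∃ r : Fin g.natDegree → ℂ, G.roots.toList = List.ofFn r := by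
    rw [← hcard]
    exact ⟨G.roots.toList.get, (List.ofFn_get _).symm⟩
  have hrim : ∀ i, (r i).im = 0 := by
    intro i
    apply hr
    have : r i ∈ G.roots := by
      rw [← Multiset.mem_toList, hrl]
      simp [List.mem_ofFn]
    have := (mem_roots hG0).1 this
    rw [IsRoot.def, hG, eval_map_algebraMap] at this
    exact this
  have hprod : G = C G.leadingCoeff * ∏ i, (X - C (r i)) := by
    conv_lhs => rw [hsp.eq_prod_roots]
    congr 1
    conv_lhs => rw [← Multiset.coe_toList G.roots, hrl]
    rw [Multiset.map_coe, Multiset.prod_coe, List.map_ofFn, List.prod_ofFn]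
    rfl
  have hne : ∀ i, z - r i ≠ 0 := by
    intro i h
    have := congrArg Complex.im h
    simp [hrim i] at this
    exact hz.ne' this
  obtain ⟨h0, h1, h2⟩ := aux_prod Finset.univ r z (fun i _ => hne i)
  have e0 : aeval z g = G.eval z := by rw [hG, eval_map_algebraMap]
  have e1 : aeval z (derivative g) = (derivative G).eval z := by
    rw [hG, derivative_map, eval_map_algebraMap]
  have e2 : aeval z (derivative (derivative g)) = (derivative (derivative G)).eval z := by
    rw [hG, derivative_map, derivative_map, eval_map_algebraMap]
  have hlc : G.leadingCoeff ≠ 0 := leadingCoeff_ne_zero.2 hG0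
  refine ⟨fun i => (z - r i)⁻¹, ?_, ?_, ?_, ?_⟩
  · intro i
    rw [Complex.inv_im]
    have : 0 < Complex.normSq (z - r i) := Complex.normSq_pos.2 (hne i)
    apply div_neg_of_neg_of_pos _ this
    simp [hrim i, hz]
  · rw [e0, hprod, eval_mul, eval_C]
    exact mul_ne_zero hlc h0
  · rw [e0, e1, hprod]
    simp only [derivative_C_mul, eval_mul, eval_C]
    rw [h1]; ring
  · rw [e0, e2, hprod]
    simp only [derivative_C_mul, eval_mul, eval_C]
    rw [h2]; ring

theorem hyp_of_upper (p : ℝ[X]) (h : ∀ z : ℂ, 0 < z.im → aeval z p ≠ 0) : Hyperbolic p := by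
  right
  intro z hz
  rcases lt_trichotomy z.im 0 with h1 | h1 | h1
  · exfalso
    apply h ((starRingEnd ℂ) z) (by simpa using h1)
    rw [Polynomial.aeval_conj, hz, map_zero]
  · exact h1
  · exact absurd hz (h z h1)

theorem hyp_const (a : ℝ) : Hyperbolic (C a) := by
  by_cases ha : a = 0
  · left; simp [ha]
  · right
    intro z hz
    simp [ha] at hz

theorem hyp_derivative (g : ℝ[X]) (hg : Hyperbolic g) : Hyperbolic (derivative g) := by
  by_cases hd : g.natDegree = 0
  · left
    exact derivative_of_natDegree_zero hd
  have hg0 : g ≠ 0 := by rintro rfl; simp at hd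
  apply hyp_of_upper
  intro z hz
  obtain ⟨w, hw, h0, h1, -⟩ := aux_repr g hg hg0 z hz
  rw [h1]
  refine mul_ne_zero h0 ?_
  intro h
  have h2 := congrArg Complex.im h
  rw [Complex.im_sum] at h2
  have : ∑ i, (w i).im < 0 :=
    Finset.sum_neg (fun i _ => hw i) ⟨⟨0, Nat.pos_of_ne_zero hd⟩, Finset.mem_univ _⟩
  simp at h2
  linarith

theorem hyp_mul (f g : ℝ[X]) (hf : Hyperbolic f) (hg : Hyperbolic g) : Hyperbolic (f * g) := by
  rcases hf with rfl | hf
  · left; simp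
  rcases hg with rfl | hg
  · left; simp
  right
  intro z hz
  rw [map_mul, mul_eq_zero] at hz
  exact hz.elim (hf z) (hg z)

theorem aux_two {d : ℕ} (hd : 2 ≤ d) (w : Fin d → ℂ) (hw : ∀ i, (w i).im < 0) :
    ∃ a b : ℂ, a.im < 0 ∧ b.im < 0 ∧ (d : ℂ) * (a + b) = 2 * ∑ i, w i ∧
      (d : ℂ) * (d - 1) * (a * b) = (∑ i, w i) ^ 2 - ∑ i, (w i) ^ 2 := by
  have hdR : (2 : ℝ) ≤ d := by exact_mod_cast hd
  have hd0 : (d : ℂ) ≠ 0 := by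
    have : d ≠ 0 := by omega
    exact_mod_cast this
  have hd1 : (d : ℂ) - 1 ≠ 0 := by
    intro h
    have h' : (d : ℂ) = 1 := by linear_combination h
    have : d = 1 := by exact_mod_cast h'
    omega
  set e := ∑ i, w i with he
  set m := e / d with hm
  set S := ∑ i, (w i - m) ^ 2 with hS
  obtain ⟨σ, hσ⟩ := IsAlgClosed.exists_pow_nat_eq (S / (d * (d - 1))) (n := 2) (by norm_num)
  have hKσ : (d : ℂ) * (d - 1) * σ ^ 2 = S := by
    rw [hσ]; field_simp
  have hSexp : S = ∑ i, (w i) ^ 2 - e ^ 2 / d := by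
    rw [hS]
    have : ∀ i, (w i - m) ^ 2 = (w i) ^ 2 - 2 * m * w i + m ^ 2 := fun i => by ring
    simp only [this, Finset.sum_add_distrib, Finset.sum_sub_distrib, ← Finset.mul_sum]
    rw [← he, hm]
    simp
    field_simp
    ring
  set K : ℝ := d * (d - 1) with hK
  have hKpos : 0 < K := by rw [hK]; nlinarith
  have hKc : (d : ℂ) * (d - 1) = (K : ℂ) := by rw [hK]; push_cast; ring
  have hmim : (d : ℝ) * m.im = ∑ i, (w i).im := by
    rw [← Complex.im_sum, ← he]
    have : e = (d : ℝ) * m := by rw [hm]; push_cast; field_simp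
    rw [this, Complex.im_ofReal_mul]
  have hnorm : K * ‖σ‖ ^ 2 ≤ ∑ i, (((w i).re - m.re) ^ 2 + ((w i).im - m.im) ^ 2) := by
    have : K * ‖σ‖ ^ 2 = ‖S‖ := by
      rw [← hKσ, hKc, norm_mul, norm_pow, Complex.norm_real, Real.norm_of_nonneg hKpos.le]
    rw [this, hS]
    refine (norm_sum_le _ _).trans (le_of_eq ?_)
    refine Finset.sum_congr rfl fun i _ => ?_
    rw [norm_pow, ← Complex.normSq_eq_norm_sq, Complex.normSq_apply]
    simp; ring
  have hre : K * (σ.re ^ 2 - σ.im ^ 2) =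
      ∑ i, (((w i).re - m.re) ^ 2 - ((w i).im - m.im) ^ 2) := by
    have := congrArg Complex.re hKσ
    rw [hKc, hS, Complex.re_sum, Complex.re_ofReal_mul] at this
    simp only [sq, Complex.mul_re, Complex.sub_re, Complex.sub_im] at this ⊢
    exact this
  have hns : ‖σ‖ ^ 2 = σ.re ^ 2 + σ.im ^ 2 := by
    rw [← Complex.normSq_eq_norm_sq, Complex.normSq_apply]; ring
  have him : K * σ.im ^ 2 ≤ ∑ i, ((w i).im - m.im) ^ 2 := by
    rw [hns] at hnorm
    rw [Finset.sum_add_distrib] at hnorm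
    rw [Finset.sum_sub_distrib] at hre
    linarith
  have hdev : ∑ i, ((w i).im - m.im) ^ 2 = ∑ i, (w i).im ^ 2 - d * m.im ^ 2 := by
    have : ∀ i, ((w i).im - m.im) ^ 2 = (w i).im ^ 2 - 2 * m.im * (w i).im + m.im ^ 2 :=
      fun i => by ring
    simp only [this, Finset.sum_add_distrib, Finset.sum_sub_distrib, ← Finset.mul_sum]
    rw [← hmim]
    simp
    ring
  have hVlt : ∀ i, ∑ j, (w j).im < (w i).im := by
    intro i
    rw [← Finset.add_sum_erase _ _ (Finset.mem_univ i)]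
    have : ∑ j ∈ Finset.univ.erase i, (w j).im < 0 := by
      apply Finset.sum_neg (fun j _ => hw j)
      rw [← Finset.card_pos, Finset.card_erase_of_mem (Finset.mem_univ i)]
      simp; omega
    linarith
  have hsq : ∑ i, (w i).im ^ 2 < (d * m.im) ^ 2 := by
    rw [hmim, sq (∑ i, (w i).im), Finset.sum_mul]
    apply Finset.sum_lt_sum_of_nonempty ⟨⟨0, by omega⟩, Finset.mem_univ _⟩
    intro i _
    nlinarith [hVlt i, hw i]
  have hmneg : m.im < 0 := by
    have : ∑ i, (w i).im < 0 :=
      Finset.sum_neg (fun i _ => hw i) ⟨⟨0, by omega⟩, Finset.mem_univ _⟩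
    nlinarith
  have hlt : σ.im ^ 2 < m.im ^ 2 := by
    have : K * σ.im ^ 2 < K * m.im ^ 2 := by
      have : K * m.im ^ 2 = (d * m.im) ^ 2 - d * m.im ^ 2 := by rw [hK]; ring
      linarith
    exact lt_of_mul_lt_mul_left this hKpos.le
  have habs : |σ.im| < -m.im := by
    rw [← abs_of_neg hmneg]
    exact sq_lt_sq.1 hlt
  obtain ⟨hl, hr⟩ := abs_lt.1 habs
  refine ⟨m + σ, m - σ, ?_, ?_, ?_, ?_⟩
  · rw [Complex.add_im]; linarith
  · rw [Complex.sub_im]; linarith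
  · rw [hm]; field_simp; ring
  · have : (d : ℂ) * (d - 1) * ((m + σ) * (m - σ)) = d * (d - 1) * m ^ 2 - S := by
      rw [← hKσ]; ring
    rw [this, hSexp, hm]
    field_simp
    ring

theorem aux_lorentz (l1 l2 u1 u2 v1 v2 m1 m2 : ℝ) (hm1 : 0 ≤ m1) (hm2 : 0 ≤ m2)
    (h : l1 * l2 = m1 * u1 * u2 + m2 * v1 * v2)
    (h1 : m1 * u1 ^ 2 + m2 * v1 ^ 2 < l1 ^ 2)
    (h2 : m1 * u2 ^ 2 + m2 * v2 ^ 2 < l2 ^ 2) : False := by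
  have p1 : 0 ≤ m1 * u1 ^ 2 + m2 * v1 ^ 2 := by positivity
  have p2 : 0 ≤ m1 * u2 ^ 2 + m2 * v2 ^ 2 := by positivity
  have a : (m1 * u1 ^ 2 + m2 * v1 ^ 2) * (m1 * u2 ^ 2 + m2 * v2 ^ 2) < l1 ^ 2 * l2 ^ 2 :=
    mul_lt_mul'' h1 h2 p1 p2
  have b : l1 ^ 2 * l2 ^ 2 = (m1 * u1 * u2 + m2 * v1 * v2) ^ 2 := by rw [← h]; ring
  have c : 0 ≤ m1 * m2 * (u1 * v2 - u2 * v1) ^ 2 := by positivity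
  nlinarith

theorem aux_stable (d c B : ℝ) (hd : 2 ≤ d) (hc : 0 < c) (hB0 : 0 ≤ B) (hB : B ≤ c ^ 2)
    (z α β : ℂ) (hz : 0 < z.im) (hα : 0 < α.im) (hβ : 0 < β.im)
    (h : (d : ℂ) * (d - 1) * z ^ 2 + c * d * z * (α + β) + B * (α * β) = d * (d - 1)) : False := by
  have hre := congrArg Complex.re h
  have him := congrArg Complex.im h
  simp [sq, -mul_eq_mul_left_iff, -mul_eq_mul_right_iff] at hre him
  set K := d * (d - 1) with hK
  have hKpos : 0 < K := by rw [hK]; nlinarith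
  have hm : 0 ≤ (c * d / 2) ^ 2 - K * B / 4 := by
    have : K * B ≤ K * c ^ 2 := by gcongr
    have : K * c ^ 2 ≤ d ^ 2 * c ^ 2 := by rw [hK]; gcongr; nlinarith
    nlinarith
  have hy : 0 < K * z.im ^ 2 + c * d * z.im * (α.im + β.im) + B * (α.im * β.im) := by
    have : 0 < d := by linarith
    positivity
  have hx : K * z.re ^ 2 + c * d * z.re * (α.re + β.re) + B * (α.re * β.re) = K +
     (K * z.im ^ 2 + c * d * z.im * (α.im + β.im) + B * (α.im * β.im)) := by
    linear_combination hre
  refine aux_lorentz (K * z.re + c * d / 2 * (α.re + β.re)) (K * z.im + c * d / 2 * (α.im + β.im))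
    (α.re + β.re) (α.im + β.im) (α.re - β.re) (α.im - β.im) _ (K * B / 4) hm (by positivity) ?_ ?_ ?_
  · linear_combination K / 2 * him
  · have := mul_pos hKpos (hKpos.trans_le (le_of_le_of_eq (by linarith) hx.symm))
    linarith
  · have := mul_pos hKpos hy
    linarith

theorem hyp_T (c B : ℝ) (hc : 0 < c) (hB0 : 0 ≤ B) (hB : B ≤ c ^ 2) (g : ℝ[X])
    (hg : Hyperbolic g) :
    Hyperbolic ((X ^ 2 - 1) * derivative (derivative g) + C (2 * c) * X * derivative g + C B * g) := by
  by_cases hd : g.natDegree = 0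
  · rw [eq_C_of_natDegree_eq_zero hd]
    simp only [derivative_C, derivative_zero, mul_zero, zero_add, ← C_mul]
    exact hyp_const _
  have hg0 : g ≠ 0 := by rintro rfl; simp at hd
  apply hyp_of_upper
  intro z hz
  obtain ⟨w, hw, h0, h1, h2⟩ := aux_repr g hg hg0 z hz
  simp only [map_add, map_mul, map_sub, map_pow, aeval_X, aeval_C, map_one]
  rw [h1, h2]
  intro h
  have h' : (z ^ 2 - 1) * ((∑ i, w i) ^ 2 - ∑ i, (w i) ^ 2) + 2 * c * z * (∑ i, w i) + B = 0 := by
    apply mul_left_cancel₀ h0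
    simp only [Complex.coe_algebraMap] at h
    push_cast at h
    linear_combination h
  have hinv : ∀ a : ℂ, a.im < 0 → a ≠ 0 ∧ 0 < (a⁻¹).im := by
    intro a ha
    have hne : a ≠ 0 := by rintro rfl; simp at ha
    refine ⟨hne, ?_⟩
    rw [Complex.inv_im]
    exact div_pos (by linarith) (Complex.normSq_pos.2 hne)
  by_cases hd1 : g.natDegree = 1
  · have key : ∀ (d : ℕ) (w : Fin d → ℂ), d = 1 → (∀ i, (w i).im < 0) →
        (z ^ 2 - 1) * ((∑ i, w i) ^ 2 - ∑ i, (w i) ^ 2) + 2 * c * z * (∑ i, w i) + B = 0 → False := by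
      rintro d w rfl hw h
      simp at h
      obtain ⟨hne, hpos⟩ := hinv _ (hw 0)
      have h3 : 2 * (c : ℂ) * z + B * (w 0)⁻¹ = 0 := by
        field_simp
        linear_combination h
      have h4 := congrArg Complex.im h3
      simp [-Complex.inv_im] at h4
      have : 0 < c * z.im := by positivity
      have : 0 ≤ B * ((w 0)⁻¹).im := by positivity
      linarith
    exact key _ w hd1 hw h'
  · obtain ⟨a, b, ha, hb, hs, hp⟩ := aux_two (by omega) w hw
    obtain ⟨hane, hapos⟩ := hinv a ha
    obtain ⟨hbne, hbpos⟩ := hinv b hb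
    refine aux_stable (g.natDegree : ℝ) c B (by exact_mod_cast (by omega : 2 ≤ g.natDegree)) hc hB0 hB
      z a⁻¹ b⁻¹ hz hapos hbpos ?_
    rw [← hp] at h'
    push_cast
    field_simp
    linear_combination h' + c * z * hs

theorem delta_apply (q : ℝ[X]) : legendreDelta q =
    (X ^ 2 - 1) * derivative (derivative q) + 2 * X * derivative q := rfl

theorem iter_delta (n : ℕ) (A : ℝ) (q : ℝ[X]) :
    derivative^[n] ((legendreDelta - A • (1 : Module.End ℝ ℝ[X])) q) =
      (X ^ 2 - 1) * derivative (derivative (derivative^[n] q)) +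
        C (2 * ((n : ℝ) + 1)) * X * derivative (derivative^[n] q) +
        C ((n : ℝ) * (n + 1) - A) * derivative^[n] q := by
  induction n with
  | zero =>
    have hC2 : (C 2 : ℝ[X]) = 2 := rfl
    simp [delta_apply, smul_eq_C_mul, hC2]
    ring
  | succ n ih =>
    rw [Function.iterate_succ_apply', ih]
    simp only [Function.iterate_succ_apply']
    simp only [derivative_add, derivative_mul, derivative_sub, derivative_X_pow, derivative_one,
      derivative_C, derivative_X]
    push_cast
    simp only [map_add, map_sub, map_mul, map_one, map_natCast]
    have hC2 : (C 2 : ℝ[X]) = 2 := rfl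
    simp [hC2]
    ring

theorem prod_range (n : ℕ) (q : ℝ[X]) :
    (((List.range n).map
      (fun k : ℕ => legendreDelta - ((k : ℝ) * (k + 1)) • (1 : Module.End ℝ (Polynomial ℝ)))).prod) q
      = derivative^[n] ((X ^ 2 - 1) ^ n * derivative^[n] q) := by
  induction n generalizing q with
  | zero => simp
  | succ n ih =>
    rw [List.range_succ, List.map_append, List.prod_append, Module.End.mul_apply, ih]
    simp only [List.map_cons, List.map_nil, List.prod_singleton]
    rw [iter_delta, Function.iterate_succ_apply, Function.iterate_succ_apply']
    congr 1
    simp only [derivative_mul, derivative_pow_succ, derivative_sub,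
      derivative_one, sub_self]
    have hC2 : (C 2 : ℝ[X]) = 2 := rfl
    simp [hC2]
    ring

theorem hyp_iter (n : ℕ) (g : ℝ[X]) (hg : Hyperbolic g) : Hyperbolic (derivative^[n] g) := by
  induction n with
  | zero => exact hg
  | succ n ih =>
    rw [Function.iterate_succ_apply']
    exact hyp_derivative _ ih

theorem hyp_sq (n : ℕ) : Hyperbolic ((X ^ 2 - 1) ^ n : ℝ[X]) := by
  right
  intro z hz
  simp only [map_pow, map_sub, aeval_X, map_one] at hz
  have h1 : (z - 1) * (z + 1) = 0 := by
    linear_combination eq_zero_of_pow_eq_zero hz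
  rcases mul_eq_zero.1 h1 with h | h
  · rw [sub_eq_zero.1 h]; simp
  · rw [eq_neg_of_add_eq_zero_left h]; simp

theorem hyp_list (n : ℕ) (L : List (Module.End ℝ ℝ[X]))
    (hL : ∀ E ∈ L, ∀ p, Hyperbolic (derivative^[n] p) → Hyperbolic (derivative^[n] (E p)))
    (p : ℝ[X]) (hp : Hyperbolic (derivative^[n] p)) : Hyperbolic (derivative^[n] (L.prod p)) := by
  induction L with
  | nil => simpa using hp
  | cons E L ih =>
    rw [List.prod_cons, Module.End.mul_apply]
    exact hL E (by simp) _ (ih (fun E2 hE2 => hL E2 (by simp [hE2])))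

theorem stmt12 (n N : ℕ) (hn : 0 < n) (hN : 0 < N) (A : Fin N → ℝ)
    (hA : ∀ j : Fin N, -((n : ℝ) + 1) ≤ A j ∧ A j ≤ (n : ℝ) * (n + 1)) :
    ∀ p : Polynomial ℝ, Hyperbolic p →
      Hyperbolic
        ((((List.range n).map
              (fun k => legendreDelta - ((k : ℝ) * (k + 1)) • (1 : Module.End ℝ (Polynomial ℝ)))).prod *
          (List.ofFn
              (fun j : Fin N => legendreDelta - A j • (1 : Module.End ℝ (Polynomial ℝ)))).prod)
          p) := by
  intro p hp
  rw [Module.End.mul_apply]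
  simp only [bind_pure_comp, List.map_eq_map, List.map_map, Function.comp_def]
  rw [prod_range]
  refine hyp_iter _ _ (hyp_mul _ _ (hyp_sq n) (hyp_list n _ ?_ p (hyp_iter n p hp)))
  intro E hE q hq
  obtain ⟨j, rfl⟩ := List.mem_ofFn.1 hE
  rw [iter_delta]
  obtain ⟨h1, h2⟩ := hA j
  exact hyp_T _ _ (by positivity) (by linarith) (by nlinarith) _ hq
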